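/- arXiv:math/0703383 — 3 statements merged into one kernel-verified Lean document; each statement's English description precedes it below -/
import Mathlib

section
/- The linear maps ω₁ and ω₂ defined on basis elements by ω₁(e_1) = e_1, ω₁(e_2) = 0, ω₁(e_k) = (k−2)e_k for k ≥ 3, and ω₂(e_1) = 0, ω₂(e_k) = e_k for k ≥ 2, are derivations of 𝔪₀ of weight 0, and every derivation of 𝔪₀ of weight 0 can be written uniquely as s·ω₁ + t·ω₂ with s,t ∈ K; in particular the space of weight-0 derivations of 𝔪₀ is 2-dimensional. -/
open Finsupp

variable (K : Type*) [Field K] [CharZero K]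

/-- Underlying space of `𝔪₀`: index `n : ℕ` represents the basis vector `e_{n+1}`. -/
abbrev V := ℕ →₀ K

/-- `e K i` is the basis vector `e_i` of `𝔪₀` for `i ≥ 1`, and `0` for `i ≤ 0`. -/
noncomputable def e (i : ℤ) : V K :=
  if 1 ≤ i then Finsupp.single (i - 1).toNat 1 else 0

/-- Structure constants of `𝔪₀`: the value of the bracket `[e_{i+1}, e_{j+1}]`,
so that `[e_1, e_i] = e_{i+1}` for `i ≥ 2` and `[e_i, e_j] = 0` for `i, j ≥ 2`. -/
noncomputable def m0c (i j : ℕ) : V K :=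
  if i = 0 ∧ 1 ≤ j then Finsupp.single (j + 1) 1
  else if j = 0 ∧ 1 ≤ i then -Finsupp.single (i + 1) 1
  else 0

/-- The (bilinear, skew-symmetric) bracket of `𝔪₀`, extended bilinearly from its
values on basis vectors. -/
noncomputable def m0br (x y : V K) : V K :=
  x.sum fun i xi => y.sum fun j yj => (xi * yj) • m0c K i j

/-- `D` is a derivation of `𝔪₀` of weight `l`: a `K`-linear map satisfying the Leibniz
rule, such that `D e_i` is a scalar multiple of `e_{i+l}` for every `i ≥ 1`
(in particular `D e_i = 0` whenever `i + l ≤ 0`, since then `e (i+l) = 0`). -/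
def IsWeightDeriv (l : ℤ) (D : V K →ₗ[K] V K) : Prop :=
  (∀ x y : V K, D (m0br K x y) = m0br K (D x) y + m0br K x (D y)) ∧
  (∀ i : ℤ, 1 ≤ i → ∃ c : K, D (e K i) = c • e K (i + l))

/-- The linear map on `V` determined by prescribing the images of the basis vectors:
`basisMap K f` sends the basis vector with index `n` (i.e. `e_{n+1}`) to `f n`. -/
noncomputable def basisMap (f : ℕ → V K) : V K →ₗ[K] V K :=
  Finsupp.lsum K fun n => LinearMap.toSpanSingleton K (V K) (f n)

/-- `ω₁`: `ω₁ e_1 = e_1`, `ω₁ e_2 = 0`, `ω₁ e_k = (k-2) e_k` for `k ≥ 3`. -/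
noncomputable def omega1 : V K →ₗ[K] V K :=
  basisMap K fun n => if n = 0 then Finsupp.single 0 1
    else ((n : K) - 1) • Finsupp.single n 1

/-- `ω₂`: `ω₂ e_1 = 0`, `ω₂ e_k = e_k` for `k ≥ 2`. -/
noncomputable def omega2 : V K →ₗ[K] V K :=
  basisMap K fun n => if n = 0 then 0 else Finsupp.single n 1

omit [CharZero K] in
/-- The bracket of `𝔪₀` as the bilinear extension of the structure constants. -/
theorem m0br_eq_linearCombination (x y : V K) :
    m0br K x y = linearCombination K (fun i => linearCombination K (m0c K i)) x y := by
  simp [m0br, linearCombination_apply, Finsupp.sum, Finset.smul_sum, mul_smul]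

omit [CharZero K] in
theorem m0br_single_single (i j : ℕ) (a b : K) :
    m0br K (single i a) (single j b) = (a * b) • m0c K i j := by
  simp [m0br]

omit [CharZero K] in
theorem basisMap_single (f : ℕ → V K) (n : ℕ) (a : K) :
    basisMap K f (single n a) = a • f n := by
  simp [basisMap]

omit [CharZero K] in
theorem e_natCast_add_one (n : ℕ) : e K ((n : ℤ) + 1) = single n 1 := by
  simp [e]

omit [CharZero K] in
/-- A linear map satisfies the Leibniz rule as soon as it does so on basis vectors. -/
theorem leibniz_of_basis (D : V K →ₗ[K] V K)
    (h : ∀ i j : ℕ, D (m0br K (single i 1) (single j 1)) =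
      m0br K (D (single i 1)) (single j 1) + m0br K (single i 1) (D (single j 1)))
    (x y : V K) : D (m0br K x y) = m0br K (D x) y + m0br K x (D y) := by
  simp only [m0br_eq_linearCombination] at h ⊢
  set B : V K →ₗ[K] V K →ₗ[K] V K :=
    linearCombination K (fun i => linearCombination K (m0c K i))
  have key : B.compr₂ D = B.comp D + B.compl₂ D := by
    ext i j : 4
    simpa using h i j
  exact LinearMap.congr_fun₂ key x y

omit [CharZero K] in
/-- A diagonal map with eigenvalues `a n`, where `a (n + 1) = a 0 + a n` for `n ≥ 1`,
is a derivation of weight `0`. -/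
theorem isWeightDeriv_zero_of_diagonal (D : V K →ₗ[K] V K) (a : ℕ → K)
    (hD : ∀ n, D (single n 1) = a n • single n 1)
    (ha : ∀ n, 1 ≤ n → a (n + 1) = a 0 + a n) : IsWeightDeriv K 0 D := by
  refine ⟨leibniz_of_basis K D fun i j => ?_, fun i hi => ?_⟩
  · simp only [hD, smul_single, smul_eq_mul, mul_one, m0br_single_single, one_mul, one_smul,
      ← add_smul]
    rcases Nat.eq_zero_or_pos i with rfl | hi <;> rcases Nat.eq_zero_or_pos j with rfl | hj
    · simp [m0c]
    · have hj' : 1 ≤ j := hj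
      simp only [m0c, hj', true_and, if_true, hD, ha j hj]
    · have hi' : 1 ≤ i := hi
      simp [m0c, hi', hi.ne', hD, ha i hi, add_comm]
    · simp [m0c, hi.ne', hj.ne']
  · obtain ⟨n, rfl⟩ : ∃ n : ℕ, i = n + 1 := ⟨(i - 1).toNat, by omega⟩
    exact ⟨a n, by rw [add_zero, e_natCast_add_one, hD]⟩

omit [CharZero K] in
theorem omega1_single (n : ℕ) :
    omega1 K (single n 1) = (if n = 0 then 1 else (n : K) - 1) • single n 1 := by
  rw [omega1, basisMap_single, one_smul]
  split_ifs with h <;> simp [h]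

omit [CharZero K] in
theorem omega2_single (n : ℕ) :
    omega2 K (single n 1) = (if n = 0 then 0 else 1 : K) • single n 1 := by
  rw [omega2, basisMap_single, one_smul]
  split_ifs with h <;> simp

omit [CharZero K] in
/-- A derivation of weight `0` is diagonal, and its eigenvalues are determined by the
first two. -/
theorem IsWeightDeriv.exists_eigenvalues {D : V K →ₗ[K] V K} (hD : IsWeightDeriv K 0 D) :
    ∃ a : ℕ → K, (∀ n, D (single n 1) = a n • single n 1) ∧
      ∀ n : ℕ, a (n + 1) = n * a 0 + a 1 := by
  obtain ⟨hL, hW⟩ := hD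
  have hW' : ∀ n : ℕ, ∃ c : K, D (single n 1) = c • single n 1 := fun n => by
    simpa only [add_zero, e_natCast_add_one] using hW (n + 1) (by omega)
  choose a ha using hW'
  refine ⟨a, ha, fun n => ?_⟩
  induction n with
  | zero => simp
  | succ n ih =>
    have h := hL (single 0 1) (single (n + 1) 1)
    simp only [ha, smul_single, smul_eq_mul, mul_one, m0br_single_single, one_mul, one_smul,
      ← add_smul] at h
    simp only [m0c, le_add_iff_nonneg_left, zero_le, and_self, if_true, ha] at h
    have h' := DFunLike.congr_fun h (n + 1 + 1)
    simp only [coe_smul, Pi.smul_apply, single_eq_same, smul_eq_mul, mul_one] at h'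
    rw [h', ih]
    push_cast
    ring

/-- `ω₁` and `ω₂` are weight-0 derivations of `𝔪₀`, and every weight-0 derivation of
`𝔪₀` is uniquely a combination `s • ω₁ + t • ω₂`; in particular the space of weight-0
derivations of `𝔪₀` is 2-dimensional. -/
theorem weight_zero_derivations :
    IsWeightDeriv K 0 (omega1 K) ∧ IsWeightDeriv K 0 (omega2 K) ∧
    ∀ D : V K →ₗ[K] V K, IsWeightDeriv K 0 D →
      ∃! st : K × K, D = st.1 • omega1 K + st.2 • omega2 K := by
  refine ⟨isWeightDeriv_zero_of_diagonal K _ _ (omega1_single K) fun n hn => ?_,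
    isWeightDeriv_zero_of_diagonal K _ _ (omega2_single K) fun n hn => ?_, fun D hD => ?_⟩
  · simp [Nat.one_le_iff_ne_zero.mp hn]
  · simp [Nat.one_le_iff_ne_zero.mp hn]
  · obtain ⟨a, ha, hrec⟩ := hD.exists_eigenvalues
    refine ⟨(a 0, a 1), ?_, ?_⟩
    · refine Finsupp.lhom_ext' fun n => LinearMap.ext_ring ?_
      simp only [LinearMap.comp_apply, lsingle_apply, LinearMap.add_apply, LinearMap.smul_apply,
        ha, omega1_single, omega2_single, smul_smul, ← add_smul]
      cases n with
      | zero => simp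
      | succ n =>
        rw [hrec n]
        simp [mul_comm]
    · rintro ⟨s, t⟩ rfl
      have h0 := DFunLike.congr_fun (ha 0) 0
      have h1 := DFunLike.congr_fun (ha 1) 1
      simp [omega1_single, omega2_single] at h0 h1
      simp [h0, h1]
end

section
/- The 3-family F_3 in weight −2 has non-zero Massey square but vanishing Massey cube. Precisely: (i) M_{−2}(F_3)(2,3,j) = 1 for every j ≥ 4, while M_{−2}(F_3)(i,j,k) = 0 for all 2 ≤ i < j < k with (i,j) ≠ (2,3); (ii) letting b : ℤ × ℤ → K be the admissible function with b(2,3) = 1 and b(i,j) = 0 for every other pair with i < j, the Massey cube vanishes identically: for all integers i,j,k, F_3(i,j)·b(i+j−2,k) + b(i,j)·F_3(i+j−4,k) + F_3(j,k)·b(j+k−2,i) + b(j,k)·F_3(j+k−4,i) + F_3(k,i)·b(k+i−2,j) + b(k,i)·F_3(k+i−4,j) = 0. -/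
/-- `a : ℤ × ℤ → K` (curried) is admissible: antisymmetric, and vanishing whenever
one of the indices is `≤ 1`. -/
def IsAdmissible {K : Type*} [Field K] (a : ℤ → ℤ → K) : Prop :=
  (∀ i j : ℤ, a j i = -a i j) ∧ (∀ i j : ℤ, i ≤ 1 ∨ j ≤ 1 → a i j = 0)

/-- `a` satisfies the cocycle recurrence `a (i+1) j + a i (j+1) = a i j` for `i, j ≥ 2`. -/
def CocycleRec {K : Type*} [Field K] (a : ℤ → ℤ → K) : Prop :=
  ∀ i j : ℤ, 2 ≤ i → 2 ≤ j → a (i + 1) j + a i (j + 1) = a i j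

/-- The weight-`l` Massey square of `a`. -/
def MasseySq {K : Type*} [Field K] (l : ℤ) (a : ℤ → ℤ → K) (i j k : ℤ) : K :=
  a i j * a (i + j + l) k + a j k * a (j + k + l) i + a k i * a (k + i + l) j

/-- Auxiliary for the `m`-family: its values on pairs `(i,j)` with `2 ≤ i < j`. -/
def famAux (K : Type*) [Field K] (m i j : ℤ) : K :=
  if 2 ≤ i ∧ i < j ∧ i ≤ m ∧ m + 1 ≤ j then
    (-1 : K) ^ (m - i).toNat * ((j - m - 1).toNat.choose (m - i).toNat : K)
  else 0

/-- The `m`-family `F_m`: for `2 ≤ i < j`, `F_m(i,j) = (-1)^(m-i) * C(j-m-1, m-i)` if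
`i ≤ m` and `j ≥ m+1`, and `0` otherwise; extended antisymmetrically, and `0` when an
index is `≤ 1`. -/
def Fam (K : Type*) [Field K] (m i j : ℤ) : K := famAux K m i j - famAux K m j i

/-- The admissible function with `b 2 3 = 1` and vanishing on every other pair `(i,j)`
with `i < j`. -/
def bCochain (K : Type*) [Field K] : ℤ → ℤ → K := fun i j =>
  if i = 2 ∧ j = 3 then 1 else if i = 3 ∧ j = 2 then -1 else 0

theorem famAux_three_three {K : Type*} [Field K] {j : ℤ} (hj : 4 ≤ j) :
    famAux K 3 3 j = 1 := by
  rw [famAux, if_pos (by omega)]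
  simp

theorem famAux_three_two {K : Type*} [Field K] {j : ℤ} (hj : 4 ≤ j) :
    famAux K 3 2 j = -((j : K) - 4) := by
  have h : (((j - 3 - 1).toNat : ℤ) : K) = ((j - 4 : ℤ) : K) := by
    congr 1
    omega
  rw [famAux, if_pos (by omega)]
  norm_num at h ⊢
  rw [h, neg_sub]

theorem famAux_eq_zero {K : Type*} [Field K] {m i j : ℤ} (h : i < 2 ∨ m < i ∨ j ≤ m) :
    famAux K m i j = 0 :=
  if_neg (by omega)

theorem fam_swap {K : Type*} [Field K] (m i j : ℤ) : Fam K m i j = -Fam K m j i := by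
  simp [Fam]

theorem fam_three_three {K : Type*} [Field K] {j : ℤ} (hj : 4 ≤ j) : Fam K 3 3 j = 1 := by
  rw [Fam, famAux_three_three hj, famAux_eq_zero (by omega), sub_zero]

theorem fam_three_two {K : Type*} [Field K] {j : ℤ} (hj : 4 ≤ j) :
    Fam K 3 2 j = -((j : K) - 4) := by
  rw [Fam, famAux_three_two hj, famAux_eq_zero (by omega), sub_zero]

theorem fam_eq_zero_of_gt {K : Type*} [Field K] {m i j : ℤ} (hi : m < i) (hj : m < j) :
    Fam K m i j = 0 := by
  rw [Fam, famAux_eq_zero (by omega), famAux_eq_zero (by omega), sub_zero]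

theorem fam_eq_zero_of_le {K : Type*} [Field K] {m i j : ℤ} (hi : i ≤ m) (hj : j ≤ m) :
    Fam K m i j = 0 := by
  rw [Fam, famAux_eq_zero (by omega), famAux_eq_zero (by omega), sub_zero]

theorem fam_eq_zero_of_le_one {K : Type*} [Field K] {m i j : ℤ} (hm : 1 ≤ m) (hi : i ≤ 1) :
    Fam K m i j = 0 := by
  rw [Fam, famAux_eq_zero (by omega), famAux_eq_zero (.inr (.inr (hi.trans hm))), sub_zero]

theorem fam_three_eq_zero_of_add_le {K : Type*} [Field K] {i j : ℤ} (h : i + j ≤ 6) :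
    Fam K 3 i j = 0 := by
  wlog hij : i ≤ j generalizing i j
  · rw [fam_swap, this (by omega) (by omega), neg_zero]
  rcases le_or_gt j 3 with hj | hj
  · exact fam_eq_zero_of_le (by omega) hj
  rcases le_or_gt i 1 with hi | hi
  · exact fam_eq_zero_of_le_one (by omega) hi
  obtain rfl : i = 2 := by omega
  obtain rfl : j = 4 := by omega
  rw [fam_three_two le_rfl]
  norm_num

theorem bCochain_eq_zero {K : Type*} [Field K] {i j : ℤ} (h : i + j ≠ 5 ∨ 3 < i ∨ 3 < j) :
    bCochain K i j = 0 := by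
  rw [bCochain, if_neg (by omega), if_neg (by omega)]

theorem fam_three_mul_bCochain {K : Type*} [Field K] (i j k : ℤ) :
    Fam K 3 i j * bCochain K (i + j - 2) k = 0 := by
  rcases le_or_gt (i + j) 6 with h | h
  · rw [fam_three_eq_zero_of_add_le h, zero_mul]
  · rw [bCochain_eq_zero (by omega), mul_zero]

theorem bCochain_mul_fam_three {K : Type*} [Field K] (i j k : ℤ) :
    bCochain K i j * Fam K 3 (i + j - 4) k = 0 := by
  by_cases h : i + j = 5
  · rw [fam_eq_zero_of_le_one (by omega) (by omega), mul_zero]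
  · rw [bCochain_eq_zero (.inl h), zero_mul]


/-- The 3-family in weight `-2` has non-zero Massey square but vanishing Massey cube:
(i) `M(2,3,j) = 1` for `j ≥ 4` while all other ordered Massey squares vanish;
(ii) with `b` the admissible cochain supported on `(2,3)`, the Massey cube vanishes
identically. -/
theorem three_family_weight_neg_two_cube_zero (K : Type*) [Field K] [CharZero K] :
    ((∀ j : ℤ, 4 ≤ j → MasseySq (-2) (Fam K 3) 2 3 j = 1) ∧
      (∀ i j k : ℤ, 2 ≤ i → i < j → j < k → (i, j) ≠ (2, 3) →
        MasseySq (-2) (Fam K 3) i j k = 0)) ∧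
    (∀ i j k : ℤ,
      Fam K 3 i j * bCochain K (i + j - 2) k + bCochain K i j * Fam K 3 (i + j - 4) k +
      Fam K 3 j k * bCochain K (j + k - 2) i + bCochain K j k * Fam K 3 (j + k - 4) i +
      Fam K 3 k i * bCochain K (k + i - 2) j + bCochain K k i * Fam K 3 (k + i - 4) j
        = 0) := by
  refine ⟨⟨fun j hj => ?_, fun i j k hi hij hjk hne => ?_⟩, fun i j k => ?_⟩
  · rw [MasseySq, fam_eq_zero_of_le (i := 2) (by omega) le_rfl, fam_three_three hj,
      fam_swap 3 _ 2, fam_three_two (by omega), fam_swap 3 j 2, fam_three_two hj,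
      fam_swap 3 _ 3, fam_three_three (by omega)]
    push_cast
    ring
  · have hj : 4 ≤ j := by
      by_contra hj
      exact hne (Prod.ext (by simp; omega) (by simp; omega))
    rw [MasseySq, fam_eq_zero_of_gt (i := i + j + -2) (by omega) (by omega),
      fam_eq_zero_of_gt (i := j) (j := k) (by omega) (by omega),
      fam_eq_zero_of_gt (i := k + i + -2) (by omega) (by omega)]
    ring
  · simp only [fam_three_mul_bCochain, bCochain_mul_fam_three, add_zero]
end

section
/- Let m ≥ 5 be an integer and let a : ℤ × ℤ → K be admissible with: a(i,j) = 0 whenever i+j ≤ m+1; a(i+1,j) + a(i,j+1) = 0 for all integers i,j ≥ 2 with i+j = m+1; a(i+1,j) + a(i,j+1) = a(i,j) for all integers i,j ≥ 2 with i+j ≥ m+2; and M_{−m}(a)(i,j,k) = 0 for all integers 2 ≤ i < j < k such that i+j ≠ 2m+1, i+k ≠ 2m+1 and j+k ≠ 2m+1 (these are exactly the weight −m Massey squares that cannot be compensated by a coboundary). Then a is a scalar multiple of the m-family: there exists t ∈ K with a(i,j) = t·F_m(i,j) for all i,j. -/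
section Massey

variable {K : Type*} [Field K] {a : ℤ → ℤ → K} {m k : ℤ}

lemma IsAdmissible.sub_const_mul {f : ℤ → ℤ → K} (ha : IsAdmissible a) (hf : IsAdmissible f)
    (z : K) : IsAdmissible fun i j => a i j - z * f i j :=
  ⟨fun i j => by linear_combination ha.1 i j - z * hf.1 i j,
    fun i j h => by simp [ha.2 i j h, hf.2 i j h]⟩

lemma CocycleRec.sub_const_mul {f : ℤ → ℤ → K} (ha : CocycleRec a) (hf : CocycleRec f)
    (z : K) : CocycleRec fun i j => a i j - z * f i j :=
  fun i j hi hj => by linear_combination ha i j hi hj - z * hf i j hi hj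

/-! ### Values of the `m`-family -/

lemma Fam_antisymm (m i j : ℤ) : Fam K m j i = -Fam K m i j := by
  simp [Fam]

lemma Fam_of_le_of_le {i j : ℤ} (hi : i ≤ m) (hj : j ≤ m) : Fam K m i j = 0 := by
  simp only [Fam, famAux]
  rw [if_neg (by lia), if_neg (by lia), sub_zero]

lemma Fam_of_lt_of_lt {i j : ℤ} (hi : m < i) (hj : m < j) : Fam K m i j = 0 := by
  simp only [Fam, famAux]
  rw [if_neg (by lia), if_neg (by lia), sub_zero]

lemma Fam_of_le_one {i j : ℤ} (h : i ≤ 1 ∨ j ≤ 1) : Fam K m i j = 0 := by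
  simp only [Fam, famAux]
  rw [if_neg (by lia), if_neg (by lia), sub_zero]

lemma Fam_sub_add (p n : ℕ) (hp : 2 ≤ m - p) :
    Fam K m (m - p) (m + 1 + n) = (-1) ^ p * (n.choose p : K) := by
  simp only [Fam, famAux]
  rw [if_pos (by lia), if_neg (by lia), sub_zero]
  have h₁ : (m - (m - (p : ℤ))).toNat = p := by lia
  have h₂ : (m + 1 + (n : ℤ) - m - 1).toNat = n := by lia
  rw [h₁, h₂]

lemma Fam_self_left (hm : 2 ≤ m) {j : ℤ} (hj : m < j) : Fam K m m j = 1 := by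
  obtain ⟨n, rfl⟩ : ∃ n : ℕ, j = m + 1 + n := ⟨(j - m - 1).toNat, by lia⟩
  simpa using Fam_sub_add (K := K) (m := m) 0 n (by simpa using hm)

lemma Fam_pred_left (hm : 3 ≤ m) {j : ℤ} (hj : m < j) :
    Fam K m (m - 1) j = -((j - m - 1 : ℤ) : K) := by
  obtain ⟨n, rfl⟩ : ∃ n : ℕ, j = m + 1 + n := ⟨(j - m - 1).toNat, by lia⟩
  have h := Fam_sub_add (K := K) (m := m) 1 n (by push_cast; lia)
  simp only [Nat.cast_one, pow_one, Nat.choose_one_right] at h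
  rw [h]
  push_cast
  ring

lemma Fam_isAdmissible (m : ℤ) : IsAdmissible (Fam K m) :=
  ⟨Fam_antisymm m, fun _ _ h => Fam_of_le_one h⟩

lemma Fam_rec_of_le_of_lt {i j : ℤ} (hi : 2 ≤ i) (him : i ≤ m) (hj : m < j) :
    Fam K m (i + 1) j + Fam K m i (j + 1) = Fam K m i j := by
  obtain ⟨n, rfl⟩ : ∃ n : ℕ, j = m + 1 + n := ⟨(j - m - 1).toNat, by lia⟩
  obtain ⟨p, rfl⟩ : ∃ p : ℕ, i = m - p := ⟨(m - i).toNat, by lia⟩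
  have h₁ := Fam_sub_add (K := K) p n hi
  have h₂ := Fam_sub_add (K := K) p (n + 1) hi
  push_cast at h₂
  rw [← add_assoc] at h₂
  rw [h₁, h₂]
  cases p with
  | zero => simp [Fam_of_lt_of_lt (K := K) (show m < m + 1 by lia) hj]
  | succ p =>
    have h₃ := Fam_sub_add (K := K) (m := m) p n (by push_cast at hi; lia)
    rw [show m - ((p + 1 : ℕ) : ℤ) + 1 = m - p by push_cast; ring, h₃, Nat.choose_succ_succ]
    push_cast
    ring

lemma Fam_cocycleRec (m : ℤ) : CocycleRec (Fam K m) := by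
  intro i j hi hj
  rcases le_or_gt i m with him | him <;> rcases le_or_gt j m with hjm | hjm
  · rw [Fam_of_le_of_le him hjm]
    rcases him.lt_or_eq with him' | rfl <;> rcases hjm.lt_or_eq with hjm' | rfl
    · rw [Fam_of_le_of_le (by lia) hjm, Fam_of_le_of_le him (by lia), add_zero]
    · obtain ⟨p, rfl⟩ : ∃ p : ℕ, i = j - (p + 1 : ℕ) := ⟨(j - i - 1).toNat, by lia⟩
      have := Fam_sub_add (K := K) (p + 1) 0 hi
      rw [Nat.cast_zero, add_zero] at this
      rw [Fam_of_le_of_le (by lia) le_rfl, this]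
      simp
    · obtain ⟨p, rfl⟩ : ∃ p : ℕ, j = i - (p + 1 : ℕ) := ⟨(i - j - 1).toNat, by lia⟩
      have := Fam_sub_add (K := K) (p + 1) 0 hj
      rw [Nat.cast_zero, add_zero] at this
      rw [Fam_of_le_of_le le_rfl (by lia), Fam_antisymm, this]
      simp
    · rw [Fam_antisymm]
      simp
  · exact Fam_rec_of_le_of_lt hi him hjm
  · rw [Fam_antisymm m j (i + 1), Fam_antisymm m (j + 1) i, Fam_antisymm m j i,
      ← Fam_rec_of_le_of_lt hj hjm him]
    ring
  · rw [Fam_of_lt_of_lt him hjm, Fam_of_lt_of_lt (by lia) hjm, Fam_of_lt_of_lt him (by lia),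
      add_zero]

/-! ### Solutions of the cocycle recurrence vanishing up to a given level -/

lemma IsAdmissible.apply_self [CharZero K] (ha : IsAdmissible a) (i : ℤ) : a i i = 0 :=
  self_eq_neg.mp (ha.1 i i)

lemma CocycleRec.level_one (hr : CocycleRec a) (hV : ∀ i j : ℤ, i + j ≤ 2 * k → a i j = 0)
    (s : ℕ) (hs : 2 ≤ k - s) : a (k - s) (k + 1 + s) = (-1) ^ s * a k (k + 1) := by
  induction s with
  | zero => simp
  | succ s ih =>
    push_cast at hs ⊢
    have h := hr (k - (s + 1)) (k + 1 + s) (by lia) (by lia)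
    rw [hV (k - (s + 1)) (k + 1 + s) (by lia), show k - ((s : ℤ) + 1) + 1 = k - s by ring,
      ih (by lia), add_assoc] at h
    linear_combination h

lemma CocycleRec.level_two [CharZero K] (hr : CocycleRec a) (ha : IsAdmissible a)
    (hV : ∀ i j : ℤ, i + j ≤ 2 * k → a i j = 0) (s : ℕ) (hs : 2 ≤ k + 1 - s) :
    a (k + 1 - s) (k + 1 + s) = (-1) ^ (s + 1) * s * a k (k + 1) := by
  induction s with
  | zero => simp [ha.apply_self]
  | succ s ih =>
    push_cast at hs ⊢
    have h := hr (k - s) (k + 1 + s) (by lia) (by lia)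
    rw [hr.level_one hV s (by lia), show k - (s : ℤ) + 1 = k + 1 - s by ring,
      ih (by lia), add_assoc] at h
    rw [show k + 1 - ((s : ℤ) + 1) = k - s by ring]
    linear_combination h

lemma CocycleRec.level_three [CharZero K] (hr : CocycleRec a) (ha : IsAdmissible a)
    (hV : ∀ i j : ℤ, i + j ≤ 2 * k → a i j = 0) (s : ℕ) (hs : 2 ≤ k + 1 - s) :
    2 * a (k + 1 - s) (k + 2 + s) =
      (-1) ^ s * (2 * a (k + 1) (k + 2) - s * (s + 1) * a k (k + 1)) := by
  induction s with
  | zero => simp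
  | succ s ih =>
    have h₂ := hr.level_two ha hV (s + 1) hs
    push_cast at hs h₂ ⊢
    have h := hr (k + 1 - (s + 1)) (k + 1 + (s + 1)) (by lia) (by lia)
    rw [h₂, show k + 1 - ((s : ℤ) + 1) + 1 = k + 1 - s by ring,
      show k + 1 + ((s : ℤ) + 1) + 1 = k + 2 + (s + 1) by ring,
      show k + 1 + ((s : ℤ) + 1) = k + 2 + s by ring] at h
    linear_combination 2 * h - ih (by lia)

lemma CocycleRec.vanish_succ [CharZero K] (hr : CocycleRec a) (ha : IsAdmissible a)
    (hV : ∀ i j : ℤ, i + j ≤ 2 * k → a i j = 0) (hk : a k (k + 1) = 0) :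
    ∀ i j : ℤ, i + j ≤ 2 * (k + 1) → a i j = 0 := by
  have key : ∀ i j : ℤ, i ≤ j → i + j ≤ 2 * (k + 1) → a i j = 0 := by
    intro i j hij hle
    rcases le_or_gt i 1 with hi | hi
    · exact ha.2 i j (Or.inl hi)
    rcases le_or_gt (i + j) (2 * k) with h | h
    · exact hV i j h
    rcases (show i + j = 2 * k + 1 ∨ i + j = 2 * k + 2 by lia) with h | h
    · obtain ⟨s, rfl⟩ : ∃ s : ℕ, i = k - s := ⟨(k - i).toNat, by lia⟩
      rw [show j = k + 1 + s by lia, hr.level_one hV s (by lia), hk, mul_zero]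
    · obtain ⟨s, rfl⟩ : ∃ s : ℕ, i = k + 1 - s := ⟨(k + 1 - i).toNat, by lia⟩
      rw [show j = k + 1 + s by lia, hr.level_two ha hV s (by lia), hk, mul_zero]
  intro i j hle
  rcases le_total i j with h | h
  · exact key i j h hle
  · rw [ha.1 j i, key j i h (by lia), neg_zero]

lemma CocycleRec.vanish_of_forall_lt [CharZero K] (hr : CocycleRec a) (ha : IsAdmissible a)
    (n : ℕ) (h : ∀ k : ℤ, k < n → (∀ i j : ℤ, i + j ≤ 2 * k → a i j = 0) → a k (k + 1) = 0) :
    ∀ i j : ℤ, i + j ≤ 2 * n → a i j = 0 := by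
  induction n with
  | zero => exact fun i j hij => ha.2 i j (by lia)
  | succ n ih =>
    have hV := ih fun k hk => h k (by push_cast; lia)
    have := hr.vanish_succ ha hV (h n (by push_cast; lia) hV)
    exact_mod_cast this

/-! ### Consequences of the vanishing of Massey squares -/

lemma massey_of_ne (ha : IsAdmissible a)
    (hM : ∀ i j k : ℤ, 2 ≤ i → i < j → j < k →
      i + j ≠ 2 * m + 1 → i + k ≠ 2 * m + 1 → j + k ≠ 2 * m + 1 →
      MasseySq (-m) a i j k = 0)
    {i j k : ℤ} (hi : 2 ≤ i) (hj : 2 ≤ j) (hk : 2 ≤ k) (hij : i ≠ j) (hik : i ≠ k) (hjk : j ≠ k)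
    (h₁ : i + j ≠ 2 * m + 1) (h₂ : i + k ≠ 2 * m + 1) (h₃ : j + k ≠ 2 * m + 1) :
    MasseySq (-m) a i j k = 0 := by
  have rot : ∀ i j k, MasseySq (-m) a i j k = MasseySq (-m) a j k i := fun i j k => by
    simp only [MasseySq]; ring
  have swap : ∀ i j k, MasseySq (-m) a i j k = -MasseySq (-m) a j i k := fun i j k => by
    simp only [MasseySq]
    rw [ha.1 i j, ha.1 i k, ha.1 k j, add_comm j i, add_comm i k, add_comm k j]
    ring
  rcases hij.lt_or_gt with hij | hij <;> rcases hik.lt_or_gt with hik | hik <;>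
    rcases hjk.lt_or_gt with hjk | hjk
  · exact hM i j k hi hij hjk h₁ h₂ h₃
  · rw [rot, rot, swap, hM i k j (by lia) (by lia) (by lia) (by lia) (by lia) (by lia), neg_zero]
  · lia
  · rw [rot, rot, hM k i j (by lia) (by lia) (by lia) (by lia) (by lia) (by lia)]
  · rw [swap, hM j i k (by lia) (by lia) (by lia) (by lia) (by lia) (by lia), neg_zero]
  · lia
  · rw [rot, hM j k i (by lia) (by lia) (by lia) (by lia) (by lia) (by lia)]
  · rw [rot, swap, hM k j i (by lia) (by lia) (by lia) (by lia) (by lia) (by lia), neg_zero]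

/-- In degree `-m` the element of index `m` acts diagonally, with eigenvalues `a i m` that are
additive along nonzero brackets. -/
lemma eigenvalue_add (hm : 2 ≤ m) (ha : IsAdmissible a)
    (hM : ∀ i j k : ℤ, 2 ≤ i → i < j → j < k →
      i + j ≠ 2 * m + 1 → i + k ≠ 2 * m + 1 → j + k ≠ 2 * m + 1 →
      MasseySq (-m) a i j k = 0)
    {i j l : ℤ} (hl : i + j = m + l) (hi : 2 ≤ i) (hj : 2 ≤ j) (hij : i ≠ j)
    (him : i ≠ m) (hjm : j ≠ m) (him' : i ≠ m + 1) (hjm' : j ≠ m + 1) (hlm : l ≠ m + 1)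
    (h0 : a i j ≠ 0) : a l m = a i m + a j m := by
  have h := massey_of_ne ha hM hi hj hm hij him hjm (by lia) (by lia) (by lia)
  simp only [MasseySq] at h
  rw [show i + j + -m = l by lia, show j + m + -m = j by lia, show m + i + -m = i by lia,
    ha.1 i j, ha.1 i m] at h
  have h' : a i j * (a l m - (a i m + a j m)) = 0 := by linear_combination h
  exact sub_eq_zero.mp ((mul_eq_zero.mp h').resolve_left h0)

/-! ### Vanishing below level `2 * m + 1` -/

variable [CharZero K]

lemma neg_one_pow_mul_ne_zero {x : K} (hx : x ≠ 0) (s : ℕ) : (-1) ^ s * x ≠ 0 :=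
  mul_ne_zero (pow_ne_zero _ (by norm_num)) hx

lemma neg_one_pow_mul_cast_mul_ne_zero {x : K} (hx : x ≠ 0) (r : ℕ) {s : ℕ} (hs : s ≠ 0) :
    (-1) ^ r * (s : K) * x ≠ 0 :=
  mul_ne_zero (neg_one_pow_mul_ne_zero (by exact_mod_cast hs) r) hx

lemma low_of_three_le (ha : IsAdmissible a) (hr : CocycleRec a)
    (hV : ∀ i j : ℤ, i + j ≤ 2 * k → a i j = 0)
    {p : ℕ} (hk : p + 4 ≤ k)
    (hM : ∀ i j l : ℤ, i + j = k + p + 1 + l → 2 ≤ i → 2 ≤ j → i ≠ j → i ≠ k + p + 1 →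
      j ≠ k + p + 1 → i ≠ k + p + 2 → j ≠ k + p + 2 → l ≠ k + p + 2 → a i j ≠ 0 →
      a l (k + p + 1) = a i (k + p + 1) + a j (k + p + 1)) : a k (k + 1) = 0 := by
  by_contra hx
  have w₁ := hr.level_one hV p (by lia)
  have w₂ := hr.level_two ha hV p (by lia)
  have n₁ := hr.level_one hV (p + 2) (by push_cast; lia)
  have n₂ := hr.level_two ha hV (p + 2) (by push_cast; lia)
  have e₁ := hM (k - (p + 2 : ℕ)) (k + 1 + (p + 2 : ℕ)) (k - p) (by push_cast; lia) (by lia)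
    (by lia) (by lia) (by lia) (by lia) (by lia) (by lia) (by lia)
    (by rw [n₁]; exact neg_one_pow_mul_ne_zero hx _)
  have e₂ := hM (k + 1 - (p + 2 : ℕ)) (k + 1 + (p + 2 : ℕ)) (k + 1 - p) (by push_cast; lia)
    (by lia) (by lia) (by lia) (by lia) (by lia) (by lia) (by lia) (by lia)
    (by rw [n₂]; exact neg_one_pow_mul_cast_mul_ne_zero hx _ (by lia))
  rw [hV (k - (p + 2 : ℕ)) _ (by push_cast; lia), show k + (p : ℤ) + 1 = k + 1 + p by ring,
    w₁] at e₁
  rw [hV (k + 1 - (p + 2 : ℕ)) _ (by push_cast; lia), show k + (p : ℤ) + 1 = k + 1 + p by ring,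
    w₂] at e₂
  refine neg_one_pow_mul_cast_mul_ne_zero hx p (s := p + 1) (by lia) ?_
  push_cast
  linear_combination e₁ - e₂

lemma low_of_two_le (ha : IsAdmissible a) (hr : CocycleRec a)
    (hV : ∀ i j : ℤ, i + j ≤ 2 * k → a i j = 0)
    {p : ℕ} (hp : 2 ≤ p) (hk : p + 2 ≤ k)
    (hM : ∀ i j l : ℤ, i + j = k + p + 1 + l → 2 ≤ i → 2 ≤ j → i ≠ j → i ≠ k + p + 1 →
      j ≠ k + p + 1 → i ≠ k + p + 2 → j ≠ k + p + 2 → l ≠ k + p + 2 → a i j ≠ 0 →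
      a l (k + p + 1) = a i (k + p + 1) + a j (k + p + 1)) : a k (k + 1) = 0 := by
  by_contra hx
  have w₁ := hr.level_one hV p (by lia)
  have w₂ := hr.level_two ha hV p (by lia)
  rw [show k + 1 + (p : ℤ) = k + p + 1 by ring] at w₁ w₂
  set w := (-1) ^ p * a k (k + 1) with hw
  have hw0 : w ≠ 0 := neg_one_pow_mul_ne_zero hx p
  have w₂' : a (k + 1 - p) (k + p + 1) = -(p * w) := by rw [w₂, hw]; ring
  have prog : ∀ s : ℕ, s ≤ p → a (k - p + s) (k + p + 1) = w * (1 - s * (p + 1)) ∧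
      a (k + p + 1 - s) (k + p + 1) = s * (p + 1) * w := by
    intro s
    induction s with
    | zero => simp [w₁, ha.apply_self]
    | succ s ih =>
      intro hs
      obtain ⟨-, ih₂⟩ := ih (by lia)
      obtain ⟨t, ht⟩ : ∃ t : ℕ, p = s + t + 1 := ⟨p - s - 1, by lia⟩
      have hu : a (k - p + (s + 1 : ℕ)) (k + p + 1) = w * (1 - (s + 1 : ℕ) * (p + 1)) := by
        rcases Nat.eq_zero_or_pos s with rfl | hs0
        · rw [show k - p + ((0 + 1 : ℕ) : ℤ) = k + 1 - p by push_cast; ring, w₂']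
          push_cast
          ring
        · have n := hr.level_two ha hV (t + 1) (by push_cast; lia)
          have e := hM (k + 1 - (t + 1 : ℕ)) (k + 1 + (t + 1 : ℕ)) (k + 1 - p) (by lia) (by lia)
            (by lia) (by lia) (by lia) (by lia) (by lia) (by lia) (by lia)
            (by rw [n]; exact neg_one_pow_mul_cast_mul_ne_zero hx _ (by lia))
          rw [show k + 1 + ((t + 1 : ℕ) : ℤ) = k + p + 1 - s by lia,
            show k + 1 - ((t + 1 : ℕ) : ℤ) = k - p + (s + 1 : ℕ) by lia, ih₂, w₂'] at e
          push_cast at e ⊢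
          linear_combination -e
      refine ⟨hu, ?_⟩
      have n := hr.level_one hV t (by lia)
      have e := hM (k - t) (k + 1 + t) (k - p) (by lia) (by lia)
        (by lia) (by lia) (by lia) (by lia) (by lia) (by lia) (by lia)
        (by rw [n]; exact neg_one_pow_mul_ne_zero hx _)
      rw [show k + 1 + (t : ℤ) = k + p + 1 - (s + 1 : ℕ) by lia,
        show k - (t : ℤ) = k - p + (s + 1 : ℕ) by lia, hu, w₁] at e
      linear_combination -e
  obtain ⟨r, rfl⟩ : ∃ r : ℕ, p = r + 2 := ⟨p - 2, by lia⟩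
  have v₁ := (prog (r + 2) le_rfl).2
  have v₂ := (prog (r + 1) (by lia)).2
  have v₃ := (prog 2 (by lia)).1
  have l₃ := hr.level_three ha hV (r + 1) (by push_cast at hk ⊢; lia)
  have hy : a (k + 1) (k + 2) ≠ 0 := by
    intro hy
    rw [hy, show k + 1 - ((r + 1 : ℕ) : ℤ) = k - (r + 2 : ℕ) + (2 : ℕ) by push_cast; ring,
      show k + 2 + ((r + 1 : ℕ) : ℤ) = k + (r + 2 : ℕ) + 1 by push_cast; ring, v₃, hw] at l₃
    refine neg_one_pow_mul_cast_mul_ne_zero hx r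
      (s := (r + 1) * (r + 2) + 2 * (2 * r + 5)) (by positivity) ?_
    push_cast at l₃ ⊢
    linear_combination -l₃
  have e := hM (k + 1) (k + 2) (k - (r + 2 : ℕ) + (2 : ℕ)) (by push_cast; ring) (by lia)
    (by lia) (by lia) (by lia) (by lia) (by lia) (by lia) (by lia) hy
  rw [show k + ((r + 2 : ℕ) : ℤ) + 1 - (r + 2 : ℕ) = k + 1 by ring] at v₁
  rw [show k + ((r + 2 : ℕ) : ℤ) + 1 - (r + 1 : ℕ) = k + 2 by push_cast; ring] at v₂
  rw [v₁, v₂, v₃] at e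
  have : (((r + 2) * (2 * r + 7) : ℕ) : K) * w = 0 := by
    push_cast at e ⊢
    linear_combination -e
  exact mul_ne_zero (Nat.cast_ne_zero.mpr (by positivity)) hw0 this

lemma CocycleRec.apply_three_four_eq_zero (ha : IsAdmissible a) (hr : CocycleRec a)
    (hV : ∀ i j : ℤ, i + j ≤ 6 → a i j = 0)
    (hM : ∀ i j l : ℤ, i + j = 5 + l → 2 ≤ i → 2 ≤ j → i ≠ j → i ≠ 5 →
      j ≠ 5 → i ≠ 6 → j ≠ 6 → l ≠ 6 → a i j ≠ 0 →
      a l 5 = a i 5 + a j 5) : a 3 4 = 0 := by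
  by_contra hx
  have a25 : a 2 5 = -a 3 4 := by
    have := hr 2 4 (by norm_num) (by norm_num)
    norm_num [hV 2 4] at this
    linear_combination this
  have step : ∀ i j : ℤ, 2 ≤ i → 2 ≤ j → a i (j + 1) = a i j - a (i + 1) j :=
    fun i j hi hj => by rw [← hr i j hi hj]; ring
  have nz : ∀ n : ℕ, n ≠ 0 → (n : K) * a 3 4 ≠ 0 := fun n hn =>
    mul_ne_zero (by exact_mod_cast hn) hx
  have a44 := ha.apply_self 4
  have a55 := ha.apply_self 5
  have a66 := ha.apply_self 6
  have s34 := step 3 4 (by norm_num) (by norm_num)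
  have s25 := step 2 5 (by norm_num) (by norm_num)
  have s35 := step 3 5 (by norm_num) (by norm_num)
  have s26 := step 2 6 (by norm_num) (by norm_num)
  have s45 := step 4 5 (by norm_num) (by norm_num)
  have s36 := step 3 6 (by norm_num) (by norm_num)
  have s56 := step 5 6 (by norm_num) (by norm_num)
  have s46 := step 4 6 (by norm_num) (by norm_num)
  have s37 := step 3 7 (by norm_num) (by norm_num)
  have s27 := step 2 7 (by norm_num) (by norm_num)
  have s47 := step 4 7 (by norm_num) (by norm_num)
  have s38 := step 3 8 (by norm_num) (by norm_num)
  have s48 := step 4 8 (by norm_num) (by norm_num)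
  norm_num at s34 s25 s35 s26 s45 s36 s56 s46 s37 s27 s47 s38 s48
  have e34 := hM 3 4 2 (by norm_num) (by norm_num) (by norm_num) (by norm_num) (by norm_num)
    (by norm_num) (by norm_num) (by norm_num) (by norm_num) hx
  have a45 : a 4 5 = -2 * a 3 4 := by linear_combination a25 - e34 - s34 + a44
  have a36 : a 3 6 = 3 * a 3 4 := by linear_combination s35 + s34 - a44 - a45
  have a27 : a 2 7 = -(5 * a 3 4) := by linear_combination s26 + s25 + a25 - s34 + a44 - a36
  have e27 := hM 2 7 4 (by norm_num) (by norm_num) (by norm_num) (by norm_num) (by norm_num)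
    (by norm_num) (by norm_num) (by norm_num) (by norm_num)
    (by rw [a27]; exact neg_ne_zero.mpr (by exact_mod_cast nz 5 (by norm_num)))
  have a57 : a 5 7 = a 3 4 := by linear_combination ha.1 7 5 - a45 + e27 + a25
  have a56 : a 5 6 = a 3 4 := by linear_combination a57 - s56 + a66
  have a46 : a 4 6 = -2 * a 3 4 := by linear_combination s45 + a45 - a55
  have a37 : a 3 7 = 5 * a 3 4 := by linear_combination s36 + a36 - a46
  have a28 : a 2 8 = -(10 * a 3 4) := by linear_combination s27 + a27 - a37
  have e28 := hM 2 8 5 (by norm_num) (by norm_num) (by norm_num) (by norm_num) (by norm_num)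
    (by norm_num) (by norm_num) (by norm_num) (by norm_num)
    (by rw [a28]; exact neg_ne_zero.mpr (by exact_mod_cast nz 10 (by norm_num)))
  have a58 : a 5 8 = -a 3 4 := by linear_combination ha.1 8 5 + e28 + a25 - a55
  have a47 : a 4 7 = -3 * a 3 4 := by linear_combination s46 + a46 - a56
  have a38 : a 3 8 = 8 * a 3 4 := by linear_combination s37 + a37 - a47
  have a48 : a 4 8 = -4 * a 3 4 := by linear_combination s47 + a47 - a57
  have a39 : a 3 9 = 12 * a 3 4 := by linear_combination s38 + a38 - a48
  have a49 : a 4 9 = -(3 * a 3 4) := by linear_combination s48 + a48 - a58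
  have e39 := hM 3 9 7 (by norm_num) (by norm_num) (by norm_num) (by norm_num) (by norm_num)
    (by norm_num) (by norm_num) (by norm_num) (by norm_num)
    (by rw [a39]; exact_mod_cast nz 12 (by norm_num))
  have e49 := hM 4 9 8 (by norm_num) (by norm_num) (by norm_num) (by norm_num) (by norm_num)
    (by norm_num) (by norm_num) (by norm_num) (by norm_num)
    (by rw [a49]; exact neg_ne_zero.mpr (by exact_mod_cast nz 3 (by norm_num)))
  have h85 := ha.1 5 8
  have h75 := ha.1 5 7
  refine nz 5 (by norm_num) ?_
  push_cast
  linear_combination e49 - e39 - h85 + h75 - a57 + a58 + a45 - s34 + a44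

lemma CocycleRec.apply_four_five_eq_zero (ha : IsAdmissible a) (hr : CocycleRec a)
    (hV : ∀ i j : ℤ, i + j ≤ 8 → a i j = 0)
    (hM : ∀ i j l : ℤ, i + j = 6 + l → 2 ≤ i → 2 ≤ j → i ≠ j → i ≠ 6 →
      j ≠ 6 → i ≠ 7 → j ≠ 7 → l ≠ 7 → a i j ≠ 0 →
      a l 6 = a i 6 + a j 6) : a 4 5 = 0 := by
  by_contra hx
  have step : ∀ i j : ℤ, 2 ≤ i → 2 ≤ j → a i (j + 1) = a i j - a (i + 1) j :=
    fun i j hi hj => by rw [← hr i j hi hj]; ring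
  have nz : ∀ n : ℕ, n ≠ 0 → (n : K) * a 4 5 ≠ 0 := fun n hn =>
    mul_ne_zero (by exact_mod_cast hn) hx
  have a55 := ha.apply_self 5
  have s35 := step 3 5 (by norm_num) (by norm_num)
  have s26 := step 2 6 (by norm_num) (by norm_num)
  have s45 := step 4 5 (by norm_num) (by norm_num)
  have s36 := step 3 6 (by norm_num) (by norm_num)
  have s27 := step 2 7 (by norm_num) (by norm_num)
  have s46 := step 4 6 (by norm_num) (by norm_num)
  have s37 := step 3 7 (by norm_num) (by norm_num)
  norm_num at s35 s26 s45 s36 s27 s46 s37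
  rw [hV 3 5 (by norm_num)] at s35
  rw [hV 2 6 (by norm_num)] at s26
  have a26 := hV 2 6 (by norm_num)
  have e45 := hM 4 5 3 (by norm_num) (by norm_num) (by norm_num) (by norm_num) (by norm_num)
    (by norm_num) (by norm_num) (by norm_num) (by norm_num) hx
  have a46 : a 4 6 = a 4 5 := by linear_combination s45 - a55
  have a56 : a 5 6 = -2 * a 4 5 := by linear_combination s35 - e45 - a46
  have a37 : a 3 7 = -2 * a 4 5 := by linear_combination s36 + s35 - a46
  have a28 : a 2 8 = 3 * a 4 5 := by linear_combination s27 + s26 - s35 - a37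
  have a47 : a 4 7 = 3 * a 4 5 := by linear_combination s46 + a46 - a56
  have a38 : a 3 8 = -(5 * a 4 5) := by linear_combination s37 + a37 - a47
  have e28 := hM 2 8 4 (by norm_num) (by norm_num) (by norm_num) (by norm_num) (by norm_num)
    (by norm_num) (by norm_num) (by norm_num) (by norm_num)
    (by rw [a28]; exact_mod_cast nz 3 (by norm_num))
  have e38 := hM 3 8 5 (by norm_num) (by norm_num) (by norm_num) (by norm_num) (by norm_num)
    (by norm_num) (by norm_num) (by norm_num) (by norm_num)
    (by rw [a38]; exact neg_ne_zero.mpr (by exact_mod_cast nz 5 (by norm_num)))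
  refine nz 2 (by norm_num) ?_
  push_cast
  linear_combination e28 - e38 + a56 - a46 - s35 + a26

lemma low_eq_zero (hm : 5 ≤ m) (ha : IsAdmissible a) (hr : CocycleRec a)
    (hlow : ∀ i j : ℤ, i + j ≤ m + 1 → a i j = 0)
    (hM : ∀ i j k : ℤ, 2 ≤ i → i < j → j < k →
      i + j ≠ 2 * m + 1 → i + k ≠ 2 * m + 1 → j + k ≠ 2 * m + 1 →
      MasseySq (-m) a i j k = 0)
    (hkm : k < m) (hV : ∀ i j : ℤ, i + j ≤ 2 * k → a i j = 0) : a k (k + 1) = 0 := by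
  rcases le_or_gt (2 * k) m with h | h
  · exact hlow _ _ (by lia)
  obtain ⟨p, rfl⟩ : ∃ p : ℕ, m = k + p + 1 := ⟨(m - k - 1).toNat, by lia⟩
  have hM' : ∀ i j l : ℤ, i + j = k + p + 1 + l → 2 ≤ i → 2 ≤ j → i ≠ j → i ≠ k + p + 1 →
      j ≠ k + p + 1 → i ≠ k + p + 2 → j ≠ k + p + 2 → l ≠ k + p + 2 → a i j ≠ 0 →
      a l (k + p + 1) = a i (k + p + 1) + a j (k + p + 1) :=
    fun i j l hl hi hj hij h₁ h₂ h₃ h₄ h₅ h0 =>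
      eigenvalue_add (by lia) ha hM hl hi hj hij h₁ h₂ (by lia) (by lia) (by lia) h0
  rcases le_or_gt ((p : ℤ) + 4) k with h₄ | h₄
  · exact low_of_three_le ha hr hV h₄ hM'
  rcases le_or_gt 2 p with h₂ | h₂
  · exact low_of_two_le ha hr hV h₂ (by lia) hM'
  obtain rfl : p = 1 := by lia
  rcases (show k = 3 ∨ k = 4 by push_cast at *; lia) with rfl | rfl
  · norm_num at hV hM' ⊢
    exact hr.apply_three_four_eq_zero ha hV hM'
  · norm_num at hV hM' ⊢
    exact hr.apply_four_five_eq_zero ha hV hM'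

/-! ### Vanishing above level `2 * m + 1` -/

lemma high_eq_zero (hm : 5 ≤ m) (ha : IsAdmissible a) (hr : CocycleRec a)
    (hM : ∀ i j k : ℤ, 2 ≤ i → i < j → j < k →
      i + j ≠ 2 * m + 1 → i + k ≠ 2 * m + 1 → j + k ≠ 2 * m + 1 →
      MasseySq (-m) a i j k = 0)
    {z : K} (hkm : m < k) (hV : ∀ i j : ℤ, i + j ≤ 2 * k → a i j = z * Fam K m i j) :
    a k (k + 1) = 0 := by
  have hF := Fam_isAdmissible (K := K) m
  have hFr := Fam_cocycleRec (K := K) m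
  set b : ℤ → ℤ → K := fun i j => a i j - z * Fam K m i j with hb
  have hbr : CocycleRec b := hr.sub_const_mul hFr z
  have hba : IsAdmissible b := ha.sub_const_mul hF z
  have hbV : ∀ i j : ℤ, i + j ≤ 2 * k → b i j = 0 := fun i j h => by
    simp only [hb]; rw [hV i j h, sub_self]
  have hab : ∀ i j, a i j = b i j + z * Fam K m i j := fun i j => by simp only [hb]; ring
  have hbk : b k (k + 1) = a k (k + 1) := by
    rw [hab, Fam_of_lt_of_lt hkm (by lia)]; ring
  have l₁ := fun s hs => hbr.level_one hbV s hs
  have l₂ := fun s hs => hbr.level_two hba hbV s hs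
  rw [hbk] at l₁ l₂
  set y := a k (k + 1) with hy
  by_contra hy0
  rcases (show k = m + 1 ∨ m + 2 ≤ k by lia) with rfl | hk
  · have h₁ := massey_of_ne ha hM (i := m - 1) (j := m + 1) (k := m + 3) (by lia) (by lia)
      (by lia) (by lia) (by lia) (by lia) (by lia) (by lia) (by lia)
    have h₂ := massey_of_ne ha hM (i := m - 2) (j := m + 1) (k := m + 2) (by lia) (by lia)
      (by lia) (by lia) (by lia) (by lia) (by lia) (by lia) (by lia)
    have f₁ := Fam_sub_add (K := K) (m := m) 2 0 (by push_cast; lia)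
    have f₂ := Fam_sub_add (K := K) (m := m) 2 1 (by push_cast; lia)
    have f₃ := Fam_sub_add (K := K) (m := m) 2 2 (by push_cast; lia)
    have v₁ := l₁ 2 (by push_cast; lia)
    have v₂ := l₂ 1 (by push_cast; lia)
    norm_num [show m + 1 - 2 = m - 1 by ring, show m + 2 - 1 = m + 1 by ring, add_assoc]
      at f₁ f₂ f₃ v₁ v₂ hy
    have a₁ : a (m - 1) (m + 1) = 0 := by
      rw [hV _ _ (by lia), Fam_pred_left (by lia) (by lia)]; push_cast; ring
    have a₂ : a (m + 1) (m + 3) = y := by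
      rw [hab, v₂, Fam_of_lt_of_lt (by lia) (by lia)]; ring
    have a₃ : a (m - 1) (m + 4) = y - 3 * z := by
      rw [hab, v₁, Fam_pred_left (by lia) (by lia)]; push_cast; ring
    have a₄ : a (m - 1) (m + 3) = -2 * z := by
      rw [hV _ _ (by lia), Fam_pred_left (by lia) (by lia)]; push_cast; ring
    have a₅ : a (m - 2) (m + 1) = 0 := by rw [hV _ _ (by lia), f₁, mul_zero]
    have a₆ : a (m - 2) (m + 2) = 0 := by rw [hV _ _ (by lia), f₂, mul_zero]
    have a₇ : a (m - 2) (m + 3) = z := by rw [hV _ _ (by lia), f₃, mul_one]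
    simp only [MasseySq] at h₁ h₂
    rw [show m + 1 + (m + 3) + -m = m + 4 by ring, show m + 3 + (m - 1) + -m = m + 2 by ring,
      a₁, a₂, ha.1 (m - 1) (m + 4), a₃, ha.1 (m - 1) (m + 3), a₄, ha.1 (m + 1) (m + 2),
      ← hy] at h₁
    rw [show m + 1 + (m + 2) + -m = m + 3 by ring, a₅, ← hy, ha.1 (m - 2) (m + 3), a₇,
      ha.1 (m - 2) (m + 2), a₆] at h₂
    have : y * y = 0 := by linear_combination -h₁ - h₂
    exact hy0 (mul_self_eq_zero.mp this)
  · have hz : z = 0 := by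
      rcases (show k = m + 2 ∨ m + 3 ≤ k by lia) with rfl | hk
      · have h := massey_of_ne ha hM (i := m - 1) (j := m + 1) (k := m + 4) (by lia) (by lia)
          (by lia) (by lia) (by lia) (by lia) (by lia) (by lia) (by lia)
        have v₁ := l₁ 1 (by push_cast; lia)
        norm_num [show m + 2 - 1 = m + 1 by ring, add_assoc] at v₁
        have a₁ : a (m - 1) (m + 1) = 0 := by
          rw [hV _ _ (by lia), Fam_pred_left (by lia) (by lia)]; push_cast; ring
        have a₂ : a (m + 1) (m + 4) = -y := by
          rw [hab, v₁, Fam_of_lt_of_lt (by lia) (by lia)]; ring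
        have a₃ : a (m - 1) (m + 5) = -4 * z := by
          rw [hV _ _ (by lia), Fam_pred_left (by lia) (by lia)]; push_cast; ring
        have a₄ : a (m + 3) (m + 1) = 0 := by
          rw [hV _ _ (by lia), Fam_of_lt_of_lt (by lia) (by lia), mul_zero]
        simp only [MasseySq] at h
        rw [show m + 1 + (m + 4) + -m = m + 5 by ring, show m + 4 + (m - 1) + -m = m + 3 by ring,
          a₁, a₂, a₄, ha.1 (m - 1) (m + 5), a₃] at h
        have : y * z = 0 := by linear_combination -h / 4
        exact (mul_eq_zero.mp this).resolve_left hy0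
      · have h := massey_of_ne ha hM (i := m - 1) (j := k) (k := k + 1) (by lia) (by lia)
          (by lia) (by lia) (by lia) (by lia) (by lia) (by lia) (by lia)
        have a₁ : a (m - 1) (2 * k + 1 - m) = -((2 * (k - m) : ℤ) : K) * z := by
          rw [hV _ _ (by lia), Fam_pred_left (by lia) (by lia)]; push_cast; ring
        have a₂ : a (k - 1) (k + 1) = 0 := by
          rw [hV _ _ (by lia), Fam_of_lt_of_lt (by lia) (by lia), mul_zero]
        simp only [MasseySq] at h
        rw [show m - 1 + k + -m = k - 1 by ring, show k + (k + 1) + -m = 2 * k + 1 - m by ring,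
          show k + 1 + (m - 1) + -m = k by ring, ha.apply_self, a₂,
          ha.1 (m - 1) (2 * k + 1 - m), a₁, ← hy] at h
        have : y * ((2 * (k - m) : ℤ) : K) * z = 0 := by linear_combination h
        refine (mul_eq_zero.mp this).resolve_left (mul_ne_zero hy0 ?_)
        exact_mod_cast (by lia : 2 * (k - m) ≠ 0)
    have e := eigenvalue_add (by lia) ha hM (i := k) (j := k + 1) (l := 2 * k + 1 - m) (by lia)
      (by lia) (by lia) (by lia) (by lia) (by lia) (by lia) (by lia) (by lia) hy0
    obtain ⟨s, hs⟩ : ∃ s : ℕ, k - s = m := ⟨(k - m).toNat, by lia⟩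
    have v := l₁ s (by lia)
    rw [hs, show k + 1 + (s : ℤ) = 2 * k + 1 - m by lia] at v
    rw [hV k m (by lia), hV (k + 1) m (by lia), ha.1 m (2 * k + 1 - m), hab, v, hz] at e
    refine neg_one_pow_mul_ne_zero hy0 s ?_
    linear_combination -e

end Massey

/-- Classification in weight `-m`, `m ≥ 5`: if `a` is admissible, vanishes for
`i + j ≤ m + 1`, satisfies `a (i+1) j + a i (j+1) = 0` for `i, j ≥ 2` with
`i + j = m + 1`, satisfies the cocycle recurrence for `i, j ≥ 2` with `i + j ≥ m + 2`,
and all non-compensable weight-`(-m)` Massey squares vanish (i.e. `M(i,j,k) = 0` for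
`2 ≤ i < j < k` with `i+j ≠ 2m+1`, `i+k ≠ 2m+1`, `j+k ≠ 2m+1`), then `a` is a scalar
multiple of the `m`-family. -/
theorem weight_neg_m_classification (K : Type*) [Field K] [CharZero K]
    (m : ℤ) (hm : 5 ≤ m)
    (a : ℤ → ℤ → K) (ha : IsAdmissible a)
    (hlow : ∀ i j : ℤ, i + j ≤ m + 1 → a i j = 0)
    (hspec : ∀ i j : ℤ, 2 ≤ i → 2 ≤ j → i + j = m + 1 →
      a (i + 1) j + a i (j + 1) = 0)
    (hrec : ∀ i j : ℤ, 2 ≤ i → 2 ≤ j → m + 2 ≤ i + j →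
      a (i + 1) j + a i (j + 1) = a i j)
    (hM : ∀ i j k : ℤ, 2 ≤ i → i < j → j < k →
      i + j ≠ 2 * m + 1 → i + k ≠ 2 * m + 1 → j + k ≠ 2 * m + 1 →
      MasseySq (-m) a i j k = 0) :
    ∃ t : K, ∀ i j : ℤ, a i j = t * Fam K m i j := by
  have hr : CocycleRec a := fun i j hi hj => by
    rcases (show i + j ≤ m ∨ i + j = m + 1 ∨ m + 2 ≤ i + j by lia) with h | h | h
    · rw [hlow _ _ (by lia), hlow _ _ (by lia), hlow _ _ (by lia), add_zero]
    · rw [hspec i j hi hj h, hlow i j h.le]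
    · exact hrec i j hi hj h
  have hF := Fam_isAdmissible (K := K) m
  have hFr := Fam_cocycleRec (K := K) m
  lift m to ℕ using by lia
  have hVa := hr.vanish_of_forall_lt ha m fun k hk hV => low_eq_zero hm ha hr hlow hM hk hV
  have hVF := hFr.vanish_of_forall_lt hF m fun k hk _ =>
    Fam_of_le_of_le hk.le (by lia)
  refine ⟨a m (m + 1), fun i j => ?_⟩
  set z := a m (m + 1) with hz
  set b : ℤ → ℤ → K := fun i j => a i j - z * Fam K m i j with hb
  have hbr : CocycleRec b := hr.sub_const_mul hFr z
  have hba : IsAdmissible b := ha.sub_const_mul hF z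
  refine sub_eq_zero.mp (hbr.vanish_of_forall_lt hba (i + j).toNat (fun k _ hV => ?_) i j
    (by lia))
  simp only [hb] at hV ⊢
  rcases lt_trichotomy k m with hk | rfl | hk
  · rw [hVa _ _ (by lia), hVF _ _ (by lia), mul_zero, sub_zero]
  · rw [Fam_self_left (by lia) (by lia), hz, mul_one, sub_self]
  · rw [Fam_of_lt_of_lt hk (by lia), mul_zero, sub_zero]
    exact high_eq_zero hm ha hr hM hk fun i j h => sub_eq_zero.mp (hV i j h)
end
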